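/- For every natural number n, Σ_{Dyck paths (h₀,…,h_{2n}) of length 2n} ∏_{i=0}^{2n} q^{h_i}/(1 − q^{2h_i+1}) = E_{2n+1}(q) / (q;q)_{2n+1}, as an identity of rational functions in q. -/

import Mathlib

attribute [local instance] Classical.propDecidable

def IsRevAlt {n : ℕ} (σ : Equiv.Perm (Fin n)) : Prop :=
  ∀ i : ℕ, (h : i + 1 < n) → (σ ⟨i + 1, h⟩ < σ ⟨i, Nat.lt_of_succ_lt h⟩ ↔ Odd i)

def descentSet {n : ℕ} (σ : Equiv.Perm (Fin n)) : Finset ℕ :=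
  (Finset.range n).filter fun i => ∃ h : i + 1 < n, σ ⟨i + 1, h⟩ < σ ⟨i, Nat.lt_of_succ_lt h⟩

def maj {n : ℕ} (σ : Equiv.Perm (Fin n)) : ℕ :=
  ∑ i ∈ descentSet σ, (i + 1)

/-- The height after `i` steps of the lattice path with step sequence `s`. -/
def pathHeight {m : ℕ} (s : Fin m → Bool) (i : ℕ) : ℤ :=
  ∑ j : Fin m, if (j : ℕ) < i then (if s j then (1 : ℤ) else -1) else 0

/-- Dyck paths of length `2n`, encoded by step sequences. -/
noncomputable def dyckPaths (n : ℕ) : Finset (Fin (2 * n) → Bool) :=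
  Finset.univ.filter fun s =>
    (∀ i ≤ 2 * n, 0 ≤ pathHeight s i) ∧ pathHeight s (2 * n) = 0

/-- The `q`-Pochhammer symbol `(q;q)_m`. -/
def qPoch {K : Type*} [Field K] (q : K) (m : ℕ) : K :=
  ∏ i ∈ Finset.range m, (1 - q ^ (i + 1))

/-- The Gaussian binomial coefficient `[a + b choose a]`. -/
def gaussBinom {K : Type*} [Field K] (q : K) (a b : ℕ) : K :=
  qPoch q (a + b) / (qPoch q a * qPoch q b)

lemma qPoch_zero {K : Type*} [Field K] (q : K) : qPoch q 0 = 1 := by simp [qPoch]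

lemma qPoch_succ {K : Type*} [Field K] (q : K) (m : ℕ) :
    qPoch q (m + 1) = qPoch q m * (1 - q ^ (m + 1)) := by
  simp [qPoch, Finset.prod_range_succ]

section Gauss

variable {K : Type*} [Field K] {q : K}

lemma one_sub_pow_succ_ne_zero (hq : ∀ n : ℕ, q ^ (n + 1) ≠ 1) (n : ℕ) :
    1 - q ^ (n + 1) ≠ 0 :=
  sub_ne_zero.mpr (hq n).symm

lemma qPoch_ne_zero (hq : ∀ n : ℕ, q ^ (n + 1) ≠ 1) (m : ℕ) : qPoch q m ≠ 0 :=
  Finset.prod_ne_zero_iff.mpr fun i _ => one_sub_pow_succ_ne_zero hq i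

lemma gaussBinom_zero_left (hq : ∀ n : ℕ, q ^ (n + 1) ≠ 1) (b : ℕ) :
    gaussBinom q 0 b = 1 := by
  have := qPoch_ne_zero hq b
  simp [gaussBinom, qPoch_zero, this]

lemma gaussBinom_zero_right (hq : ∀ n : ℕ, q ^ (n + 1) ≠ 1) (a : ℕ) :
    gaussBinom q a 0 = 1 := by
  have := qPoch_ne_zero hq a
  simp [gaussBinom, qPoch_zero, this]

lemma gaussBinom_pascal_left (hq : ∀ n : ℕ, q ^ (n + 1) ≠ 1) (a b : ℕ) :
    gaussBinom q (a + 1) (b + 1) =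
      q ^ (b + 1) * gaussBinom q a (b + 1) + gaussBinom q (a + 1) b := by
  have h1 := qPoch_ne_zero hq a
  have h2 := qPoch_ne_zero hq b
  have h3 := one_sub_pow_succ_ne_zero hq a
  have h4 := one_sub_pow_succ_ne_zero hq b
  simp only [gaussBinom, show a + 1 + (b + 1) = a + b + 1 + 1 by ring,
    show a + (b + 1) = a + b + 1 by ring, show a + 1 + b = a + b + 1 by ring, qPoch_succ]
  field_simp
  ring

lemma gaussBinom_pascal_right (hq : ∀ n : ℕ, q ^ (n + 1) ≠ 1) (a b : ℕ) :
    gaussBinom q (a + 1) (b + 1) =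
      gaussBinom q a (b + 1) + q ^ (a + 1) * gaussBinom q (a + 1) b := by
  have h1 := qPoch_ne_zero hq a
  have h2 := qPoch_ne_zero hq b
  have h3 := one_sub_pow_succ_ne_zero hq a
  have h4 := one_sub_pow_succ_ne_zero hq b
  simp only [gaussBinom, show a + 1 + (b + 1) = a + b + 1 + 1 by ring,
    show a + (b + 1) = a + b + 1 by ring, show a + 1 + b = a + b + 1 by ring, qPoch_succ]
  field_simp
  ring

end Gauss

/-- The elements of `S` that may come last in an enumeration of `S` in which `i` precedes `j`
whenever `R i j`. -/
noncomputable def maximals (R : ℕ → ℕ → Prop) (S : Finset ℕ) : Finset ℕ :=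
  S.filter fun y => ∀ z ∈ S, ¬ R y z

/-- The generating function of the major index of the words obtained by appending `x` to an
`R`-compatible enumeration of the `k`-element set `S`. -/
noncomputable def extSum {K : Type*} [Field K] (q : K) (R : ℕ → ℕ → Prop) :
    ℕ → Finset ℕ → ℕ → K
  | 0, _, _ => 1
  | k + 1, S, x => ∑ y ∈ maximals R S,
      (if x < y then q ^ (k + 1) else 1) * extSum q R k (S.erase y) y

lemma extSum_map_add {K : Type*} [Field K] (q : K) (R : ℕ → ℕ → Prop) (c k : ℕ)
    (S : Finset ℕ) (x : ℕ) :
    extSum q R k (S.map (addRightEmbedding c)) (x + c) =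
      extSum q (fun i j => R (i + c) (j + c)) k S x := by
  induction k generalizing S x with
  | zero => rfl
  | succ k ih =>
    have hm : maximals R (S.map (addRightEmbedding c)) =
        (maximals (fun i j => R (i + c) (j + c)) S).map (addRightEmbedding c) := by
      ext y
      simp only [maximals, Finset.mem_filter, Finset.mem_map, addRightEmbedding_apply]
      constructor
      · rintro ⟨⟨a, ha, rfl⟩, h⟩
        exact ⟨a, ⟨ha, fun z hz => h _ ⟨z, hz, rfl⟩⟩, rfl⟩
      · rintro ⟨a, ⟨ha, h⟩, rfl⟩
        refine ⟨⟨a, ha, rfl⟩, ?_⟩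
        rintro _ ⟨z, hz, rfl⟩
        exact h z hz
    simp only [extSum, hm, Finset.sum_map]
    refine Finset.sum_congr rfl fun y _ => ?_
    rw [← ih, Finset.map_erase]
    simp

lemma extSum_congr {K : Type*} [Field K] (q : K) {R R' : ℕ → ℕ → Prop} (k : ℕ) (S : Finset ℕ)
    (x : ℕ) (h : ∀ i ∈ S, ∀ j ∈ S, (R i j ↔ R' i j)) :
    extSum q R k S x = extSum q R' k S x := by
  induction k generalizing S x with
  | zero => rfl
  | succ k ih =>
    have hm : maximals R S = maximals R' S :=
      Finset.filter_congr fun y hy => forall₂_congr fun z hz => not_congr (h y hy z hz)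
    simp only [extSum, hm]
    refine Finset.sum_congr rfl fun y _ => ?_
    rw [ih _ _ fun i hi j hj => h i (Finset.mem_of_mem_erase hi) j (Finset.mem_of_mem_erase hj)]

section Shuffle

variable {a m : ℕ} {R : ℕ → ℕ → Prop}

lemma maximals_range_union (hchain : ∀ j, j + 1 < a → R j (j + 1))
    (hlow : ∀ j y, j < a → R j y → j < y ∧ y < a)
    (hhigh : ∀ y z, a ≤ y → R y z → a ≤ z) {i : ℕ} (hi : i + 1 ≤ a) {B : Finset ℕ}
    (hB : B ⊆ Finset.Ico a m) :
    maximals R (Finset.range (i + 1) ∪ B) = insert i (maximals R B) := by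
  have hB' : ∀ b ∈ B, a ≤ b := fun b hb => (Finset.mem_Ico.mp (hB hb)).1
  ext y
  simp only [maximals, Finset.mem_filter, Finset.mem_union, Finset.mem_range, Finset.mem_insert]
  constructor
  · rintro ⟨hy | hy, h⟩
    · left
      by_contra hne
      exact h (y + 1) (by left; omega) (hchain y (by omega))
    · exact Or.inr ⟨hy, fun z hz => h z (Or.inr hz)⟩
  · rintro (rfl | ⟨hy, h⟩)
    · refine ⟨by left; omega, fun z hz hR => ?_⟩
      have := hlow y z (by omega) hR
      rcases hz with hz | hz
      · omega
      · have := hB' z hz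
        omega
    · refine ⟨Or.inr hy, fun z hz hR => ?_⟩
      rcases hz with hz | hz
      · have := hhigh y z (hB' y hy) hR
        omega
      · exact h z hz hR

/-- Shuffling the chain `0, …, i - 1` into the enumerations of a set of larger elements multiplies
the generating function of the major index by a Gaussian binomial coefficient. -/
lemma extSum_range_union {K : Type*} [Field K] {q : K} (hq : ∀ n : ℕ, q ^ (n + 1) ≠ 1)
    (hchain : ∀ j, j + 1 < a → R j (j + 1))
    (hlow : ∀ j y, j < a → R j y → j < y ∧ y < a)
    (hhigh : ∀ y z, a ≤ y → R y z → a ≤ z) (k : ℕ) :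
    ∀ i b : ℕ, i + b = k → i ≤ a → ∀ B ⊆ Finset.Ico a m, B.card = b →
      (∀ x, a ≤ x → extSum q R k (Finset.range i ∪ B) x =
        gaussBinom q i b * extSum q R b B x) ∧
      (i < a → extSum q R k (Finset.range i ∪ B) i =
        q ^ b * gaussBinom q i b * extSum q R b B m) := by
  induction k with
  | zero =>
    intro i b hib hia B hB hBc
    obtain rfl : i = 0 := by omega
    obtain rfl : b = 0 := by omega
    simp [extSum, gaussBinom_zero_left hq]
  | succ k ih =>
    intro i b hib hia B hB hBc
    have hB' : ∀ y ∈ B, a ≤ y ∧ y < m := fun y hy => Finset.mem_Ico.mp (hB hy)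
    have hmB : ∀ y ∈ maximals R B, y ∈ B := fun y hy => (Finset.mem_filter.mp hy).1
    rcases i with _ | i
    · obtain rfl : b = k + 1 := by omega
      refine ⟨fun x _ => by simp [gaussBinom_zero_left hq], fun h0 => ?_⟩
      simp only [Finset.range_zero, Finset.empty_union, extSum, gaussBinom_zero_left hq, mul_one,
        Finset.mul_sum]
      refine Finset.sum_congr rfl fun y hy => ?_
      have := hB' y (hmB y hy)
      rw [if_pos (by omega), if_neg (by omega), one_mul]
    · have hsplit : ∀ x, extSum q R (k + 1) (Finset.range (i + 1) ∪ B) x =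
          (if x < i then q ^ (k + 1) else 1) * (q ^ b * gaussBinom q i b * extSum q R b B m) +
          ∑ y ∈ maximals R B, (if x < y then q ^ (k + 1) else 1) *
            (gaussBinom q (i + 1) (b - 1) * extSum q R (b - 1) (B.erase y) y) := by
        intro x
        have hni : i ∉ B := fun h => by have := hB' i h; omega
        rw [extSum, maximals_range_union hchain hlow hhigh hia hB, Finset.sum_insert
          fun h => hni (hmB i h)]
        congr 1
        · have he : (Finset.range (i + 1) ∪ B).erase i = Finset.range i ∪ B := by
            rw [Finset.erase_union_distrib, Finset.erase_eq_of_notMem hni]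
            congr 1
            ext z
            simp only [Finset.mem_erase, Finset.mem_range]
            omega
          rw [he, (ih i b (by omega) (by omega) B hB hBc).2 (by omega)]
        · refine Finset.sum_congr rfl fun y hy => ?_
          have hyB := hmB y hy
          have := hB' y hyB
          have hbpos : 0 < b := hBc ▸ Finset.card_pos.mpr ⟨y, hyB⟩
          have he : (Finset.range (i + 1) ∪ B).erase y = Finset.range (i + 1) ∪ B.erase y := by
            rw [Finset.erase_union_distrib, Finset.erase_eq_of_notMem (a := y)]
            simp only [Finset.mem_range]
            omega
          rw [he, (ih (i + 1) (b - 1) (by omega) hia (B.erase y)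
            ((Finset.erase_subset _ _).trans hB)
            (by rw [Finset.card_erase_of_mem hyB, hBc])).1 y (by omega)]
      rcases b with _ | b
      · obtain rfl : B = ∅ := Finset.card_eq_zero.mp hBc
        have hmE : maximals R ∅ = ∅ := by simp [maximals]
        refine ⟨fun x hx => ?_, fun _ => ?_⟩
        · rw [hsplit x, hmE, if_neg (by omega)]
          simp [extSum, gaussBinom_zero_right hq]
        · rw [hsplit (i + 1), hmE, if_neg (by omega)]
          simp [extSum, gaussBinom_zero_right hq]
      · have hk : k = i + b + 1 := by omega
        subst hk
        refine ⟨fun x hx => ?_, fun hi => ?_⟩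
        · rw [hsplit x, if_neg (by omega)]
          simp only [extSum, Finset.mul_sum, ← Finset.sum_add_distrib, Nat.add_sub_cancel]
          refine Finset.sum_congr rfl fun y hy => ?_
          have := hB' y (hmB y hy)
          rw [if_neg (show ¬ m < y by omega)]
          split_ifs
          · rw [gaussBinom_pascal_right hq]
            ring
          · rw [gaussBinom_pascal_left hq]
            ring
        · rw [hsplit (i + 1), if_neg (by omega)]
          simp only [extSum, Finset.mul_sum, ← Finset.sum_add_distrib, Nat.add_sub_cancel]
          refine Finset.sum_congr rfl fun y hy => ?_
          have := hB' y (hmB y hy)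
          rw [if_neg (show ¬ m < y by omega), if_pos (by omega), gaussBinom_pascal_right hq]
          ring

end Shuffle

/-- The major index of a word. -/
noncomputable def wordMaj {k : ℕ} (w : Fin (k + 1) → ℕ) : ℕ :=
  ∑ i : Fin k, if w i.succ < w i.castSucc then (i : ℕ) + 1 else 0

lemma wordMaj_snoc {k : ℕ} (w : Fin (k + 1) → ℕ) (x : ℕ) :
    wordMaj (Fin.snoc w x : Fin (k + 2) → ℕ) =
      wordMaj w + if x < w (Fin.last k) then k + 1 else 0 := by
  rw [wordMaj, Fin.sum_univ_castSucc, wordMaj]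
  congr 1
  · refine Finset.sum_congr rfl fun i _ => ?_
    rw [Fin.succ_castSucc, Fin.snoc_castSucc, Fin.snoc_castSucc]
    simp
  · rw [Fin.succ_last, Fin.snoc_last, Fin.snoc_castSucc]
    simp

/-- `f` enumerates `S` without repetition, listing `i` before `j` whenever `R i j`. -/
def IsExt {m k : ℕ} (R : ℕ → ℕ → Prop) (S : Finset ℕ) (f : Fin k → Fin m) : Prop :=
  Function.Injective f ∧ (∀ y, y ∈ S ↔ ∃ i, (f i : ℕ) = y) ∧ ∀ i j, R (f i) (f j) → i < j

lemma isExt_snoc {m k : ℕ} (R : ℕ → ℕ → Prop) (S : Finset ℕ) (g : Fin k → Fin m) (y : Fin m) :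
    IsExt R S (Fin.snoc g y : Fin (k + 1) → Fin m) ↔
      (y : ℕ) ∈ maximals R S ∧ IsExt R (S.erase y) g := by
  constructor
  · rintro ⟨hinj, hS, hR⟩
    have hyS : (y : ℕ) ∈ S := (hS _).mpr ⟨Fin.last k, by simp⟩
    have hne : ∀ i, (g i : ℕ) ≠ y := fun i h => by
      have : (Fin.snoc g y : Fin (k + 1) → Fin m) i.castSucc =
          (Fin.snoc g y : Fin (k + 1) → Fin m) (Fin.last k) := by
        simpa [Fin.ext_iff] using h
      exact (Fin.castSucc_lt_last i).ne (hinj this)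
    refine ⟨Finset.mem_filter.mpr ⟨hyS, fun z hz hyz => ?_⟩, ?_, ?_, ?_⟩
    · obtain ⟨i, rfl⟩ := (hS z).mp hz
      exact (Fin.le_last i).not_gt (hR (Fin.last k) i (by simpa using hyz))
    · intro i j h
      have : (Fin.snoc g y : Fin (k + 1) → Fin m) i.castSucc =
          (Fin.snoc g y : Fin (k + 1) → Fin m) j.castSucc := by simpa using h
      exact Fin.castSucc_injective _ (hinj this)
    · intro z
      rw [Finset.mem_erase, hS]
      constructor
      · rintro ⟨hz, i, rfl⟩
        induction i using Fin.lastCases with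
        | last => simp at hz
        | cast i => exact ⟨i, by simp⟩
      · rintro ⟨i, rfl⟩
        exact ⟨hne i, i.castSucc, by simp⟩
    · intro i j h
      exact Fin.castSucc_lt_castSucc_iff.mp (hR i.castSucc j.castSucc (by simpa using h))
  · rintro ⟨hy, hinj, hS, hR⟩
    obtain ⟨hyS, hmax⟩ := Finset.mem_filter.mp hy
    have hne : ∀ i, (g i : ℕ) ≠ y ∧ (g i : ℕ) ∈ S := fun i =>
      Finset.mem_erase.mp ((hS _).mpr ⟨i, rfl⟩)
    refine ⟨?_, ?_, ?_⟩
    · intro i j h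
      induction i using Fin.lastCases with
      | last =>
        induction j using Fin.lastCases with
        | last => rfl
        | cast j => simp [Fin.ext_iff] at h; exact absurd h.symm (hne j).1
      | cast i =>
        induction j using Fin.lastCases with
        | last => simp [Fin.ext_iff] at h; exact absurd h (hne i).1
        | cast j => simp at h; rw [hinj h]
    · intro z
      constructor
      · intro hz
        by_cases hzy : z = y
        · exact ⟨Fin.last k, by simp [hzy]⟩
        · obtain ⟨i, hi⟩ := (hS z).mp (Finset.mem_erase.mpr ⟨hzy, hz⟩)
          exact ⟨i.castSucc, by simpa using hi⟩
      · rintro ⟨i, rfl⟩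
        induction i using Fin.lastCases with
        | last => simpa using hyS
        | cast i => simpa using (hne i).2
    · intro i j h
      induction i using Fin.lastCases with
      | last =>
        induction j using Fin.lastCases with
        | last => exact absurd (by simpa using h) (hmax y hyS)
        | cast j => exact absurd (by simpa using h) (hmax _ (hne j).2)
      | cast i =>
        induction j using Fin.lastCases with
        | last => exact Fin.castSucc_lt_last i
        | cast j => exact Fin.castSucc_lt_castSucc_iff.mpr (hR i j (by simpa using h))

lemma sum_isExt {K : Type*} [Field K] (q : K) {m : ℕ} (R : ℕ → ℕ → Prop) (k : ℕ) :
    ∀ S ⊆ Finset.range m, S.card = k → ∀ x : ℕ,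
      (∑ f : Fin k → Fin m, if IsExt R S f then
        q ^ wordMaj (Fin.snoc (fun i => (f i : ℕ)) x : Fin (k + 1) → ℕ) else 0) =
      extSum q R k S x := by
  induction k with
  | zero =>
    intro S _ hc x
    obtain rfl : S = ∅ := Finset.card_eq_zero.mp hc
    simp [extSum, IsExt, wordMaj, Function.injective_of_subsingleton]
  | succ k ih =>
    intro S hS hc x
    rw [← (Fin.snocEquiv fun _ : Fin (k + 1) => Fin m).sum_comp, Fintype.sum_prod_type, extSum]
    have hmS : maximals R S ⊆ S := Finset.filter_subset _ _
    have key : ∀ y : Fin m, (∑ g : Fin k → Fin m,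
        if IsExt R S ((Fin.snocEquiv fun _ : Fin (k + 1) => Fin m) (y, g)) then
          q ^ wordMaj (Fin.snoc (fun i =>
            (((Fin.snocEquiv fun _ : Fin (k + 1) => Fin m) (y, g)) i : ℕ)) x :
              Fin (k + 2) → ℕ) else 0) =
        if (y : ℕ) ∈ maximals R S then
          (if x < (y : ℕ) then q ^ (k + 1) else 1) * extSum q R k (S.erase y) y else 0 := by
      intro y
      by_cases hy : (y : ℕ) ∈ maximals R S
      · rw [if_pos hy, ← ih (S.erase y) ((Finset.erase_subset _ _).trans hS)
          (by rw [Finset.card_erase_of_mem (hmS hy), hc]; rfl), Finset.mul_sum]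
        refine Finset.sum_congr rfl fun g _ => ?_
        have hw : (fun i => (((Fin.snocEquiv fun _ : Fin (k + 1) => Fin m) (y, g)) i : ℕ)) =
            (Fin.snoc (fun i => (g i : ℕ)) (y : ℕ) : Fin (k + 1) → ℕ) := by
          funext i
          induction i using Fin.lastCases with
          | last => simp [Fin.snocEquiv]
          | cast i => simp [Fin.snocEquiv]
        have he : IsExt R S ((Fin.snocEquiv fun _ : Fin (k + 1) => Fin m) (y, g)) ↔
            IsExt R (S.erase y) g := by
          rw [← and_iff_right (a := (y : ℕ) ∈ maximals R S) (b := IsExt R (S.erase y) g) hy]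
          exact isExt_snoc R S g y
        rw [hw, wordMaj_snoc, Fin.snoc_last, pow_add]
        simp only [he]
        split_ifs <;> simp [mul_comm]
      · rw [if_neg hy]
        refine Finset.sum_eq_zero fun g _ => if_neg fun h => hy ?_
        exact ((isExt_snoc R S g y).mp h).1
    rw [Finset.sum_congr rfl fun y _ => key y, Fin.sum_univ_eq_sum_range (fun y =>
      if y ∈ maximals R S then
        (if x < y then q ^ (k + 1) else 1) * extSum q R k (S.erase y) y else 0) m,
      ← Finset.sum_filter, Finset.filter_mem_eq_inter,
      Finset.inter_eq_right.mpr (hmS.trans hS)]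

lemma wordMaj_eq_maj {m : ℕ} (τ : Equiv.Perm (Fin m)) :
    wordMaj (Fin.snoc (fun i => (τ i : ℕ)) m : Fin (m + 1) → ℕ) = maj τ := by
  rw [maj, descentSet, Finset.sum_filter, Finset.sum_range, wordMaj]
  refine Finset.sum_congr rfl fun i _ => ?_
  rw [Fin.snoc_castSucc]
  refine if_congr ?_ rfl rfl
  by_cases hi : (i : ℕ) + 1 < m
  · have : i.succ = Fin.castSucc ⟨i + 1, hi⟩ := rfl
    rw [this, Fin.snoc_castSucc]
    simp [hi]
  · have : i.succ = Fin.last m := by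
      ext
      simp
      omega
    rw [this, Fin.snoc_last]
    simp [hi, (τ i).isLt.le]

lemma sum_perm_eq_extSum {K : Type*} [Field K] (q : K) (m : ℕ) (R : ℕ → ℕ → Prop) :
    (∑ σ : Equiv.Perm (Fin m), if (∀ i j : Fin m, R i j → σ i < σ j) then
      q ^ maj σ⁻¹ else 0) = extSum q R m (Finset.range m) m := by
  rw [← sum_isExt q R m _ subset_rfl (Finset.card_range m),
    ← Equiv.sum_comp (Equiv.inv (Equiv.Perm (Fin m)))]
  simp only [Equiv.inv_apply, inv_inv]
  symm
  rw [← Finset.sum_filter, ← Finset.sum_filter]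
  symm
  refine Finset.sum_bij (fun τ _ => (τ : Fin m → Fin m)) ?_ ?_ ?_ ?_
  · intro τ hτ
    simp only [Finset.mem_filter, Finset.mem_univ, true_and] at hτ ⊢
    refine ⟨τ.injective, fun y => ?_, fun i j h => by simpa using hτ _ _ h⟩
    rw [Finset.mem_range]
    exact ⟨fun h => ⟨τ⁻¹ ⟨y, h⟩, by simp⟩, fun ⟨i, hi⟩ => hi ▸ (τ i).isLt⟩
  · intro τ _ τ' _ h
    exact Equiv.coe_fn_injective h
  · intro f hf
    simp only [Finset.mem_filter, Finset.mem_univ, true_and] at hf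
    refine ⟨Equiv.ofBijective f (Finite.injective_iff_bijective.mp hf.1), ?_, rfl⟩
    simp only [Finset.mem_filter, Finset.mem_univ, true_and]
    intro i j h
    apply hf.2.2
    have e : ∀ i, f ((Equiv.ofBijective f (Finite.injective_iff_bijective.mp hf.1))⁻¹ i) = i :=
      fun i => Equiv.apply_symm_apply
        (Equiv.ofBijective f (Finite.injective_iff_bijective.mp hf.1)) i
    rw [e, e]
    exact h
  · intro τ _
    rw [wordMaj_eq_maj]

/-- Sum of `q ^ maj σ⁻¹` over the permutations `σ` of `Fin m` which increase on the first
`2 * k + 1` positions and are reverse alternating from there on. -/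
noncomputable def tailAltSum {K : Type*} [Field K] (q : K) (m k : ℕ) : K :=
  ∑ σ : Equiv.Perm (Fin m), if (∀ i : ℕ, (h : i + 1 < m) →
    (σ ⟨i + 1, h⟩ < σ ⟨i, Nat.lt_of_succ_lt h⟩ ↔ Odd i ∧ 2 * k ≤ i)) then
      q ^ maj σ⁻¹ else 0

/-- The covering relation of the disjoint union of the chain on `0, …, 2 * k - 1` and the zigzag
on the larger numbers. -/
def chainZigzag (k i j : ℕ) : Prop :=
  (j = i + 1 ∧ (i + 1 < 2 * k ∨ (2 * k ≤ i ∧ Even i))) ∨ (i = j + 1 ∧ 2 * k ≤ j ∧ Odd j)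

lemma forall_chainZigzag_iff {m : ℕ} (k : ℕ) (σ : Equiv.Perm (Fin m)) :
    (∀ i j : Fin m, chainZigzag k i j → σ i < σ j) ↔
      ∀ i : ℕ, (h : i + 1 < m) → i + 1 ≠ 2 * k →
        (σ ⟨i + 1, h⟩ < σ ⟨i, Nat.lt_of_succ_lt h⟩ ↔ Odd i ∧ 2 * k ≤ i) := by
  constructor
  · intro H i h hi
    constructor
    · intro hlt
      by_contra hc
      refine lt_asymm hlt (H ⟨i, _⟩ ⟨i + 1, h⟩ (Or.inl ⟨rfl, ?_⟩))
      rw [Nat.even_iff]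
      rw [Nat.odd_iff] at hc
      dsimp only
      omega
    · rintro ⟨h1, h2⟩
      exact H ⟨i + 1, h⟩ ⟨i, _⟩ (Or.inr ⟨rfl, h2, h1⟩)
  · rintro H ⟨i, hi⟩ ⟨j, hj⟩ (⟨h1, h2⟩ | ⟨h1, h2, h3⟩) <;> dsimp only at h1 h2
    · subst h1
      have := H i hj (by rw [Nat.even_iff] at h2; omega)
      refine lt_of_le_of_ne (not_lt.mp fun hlt => ?_) fun he => ?_
      · have := this.mp hlt
        rw [Nat.even_iff] at h2
        rw [Nat.odd_iff] at this
        omega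
      · have := σ.injective he
        simp at this
    · subst h1
      exact (H j hi (by omega)).mpr ⟨h3, h2⟩

section Tangent

variable {K : Type*} [Field K] {q : K}

lemma extSum_chainZigzag_zero (m : ℕ) :
    extSum q (chainZigzag 0) m (Finset.range m) m =
      ∑ σ : Equiv.Perm (Fin m), if IsRevAlt σ then q ^ maj σ⁻¹ else 0 := by
  rw [← sum_perm_eq_extSum]
  refine Finset.sum_congr rfl fun σ _ => if_congr ?_ rfl rfl
  simp [forall_chainZigzag_iff, IsRevAlt]

lemma tailAltSum_zero (m : ℕ) :
    tailAltSum q m 0 = ∑ σ : Equiv.Perm (Fin m), if IsRevAlt σ then q ^ maj σ⁻¹ else 0 := by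
  refine Finset.sum_congr rfl fun σ _ => if_congr ?_ rfl rfl
  simp [IsRevAlt]

/-- Splitting according to whether there is a descent after the first `2 * (k + 1)` positions. -/
lemma extSum_chainZigzag_succ {m k : ℕ} (hk : 2 * (k + 1) < m) :
    extSum q (chainZigzag (k + 1)) m (Finset.range m) m =
      tailAltSum q m (k + 1) + tailAltSum q m k := by
  rw [← sum_perm_eq_extSum, tailAltSum, tailAltSum, ← Finset.sum_add_distrib]
  refine Finset.sum_congr rfl fun σ _ => ?_
  have hodd : Odd (2 * k + 1) := ⟨k, rfl⟩
  have hk' : 2 * k + 1 + 1 < m := by omega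
  rw [if_congr (forall_chainZigzag_iff (k + 1) σ) rfl rfl]
  by_cases hd : σ ⟨2 * k + 1 + 1, hk'⟩ < σ ⟨2 * k + 1, by omega⟩
  · rw [if_neg (c := ∀ i : ℕ, (h : i + 1 < m) →
      (σ ⟨i + 1, h⟩ < σ ⟨i, Nat.lt_of_succ_lt h⟩ ↔ Odd i ∧ 2 * (k + 1) ≤ i))
      (fun H => by have := (H _ hk').mp hd; omega), zero_add]
    refine if_congr ⟨fun H i h => ?_, fun H i h hi => ?_⟩ rfl rfl
    · by_cases hi : i = 2 * k + 1
      · subst hi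
        exact ⟨fun _ => ⟨hodd, by omega⟩, fun _ => hd⟩
      · rw [H i h (by omega)]
        refine and_congr_right fun ho => ?_
        rw [Nat.odd_iff] at ho
        omega
    · rw [H i h]
      refine and_congr_right fun ho => ?_
      rw [Nat.odd_iff] at ho
      omega
  · rw [if_neg (c := ∀ i : ℕ, (h : i + 1 < m) →
      (σ ⟨i + 1, h⟩ < σ ⟨i, Nat.lt_of_succ_lt h⟩ ↔ Odd i ∧ 2 * k ≤ i))
      (fun H => hd ((H _ hk').mpr ⟨hodd, by omega⟩)), add_zero]
    refine if_congr ⟨fun H i h => ?_, fun H i h hi => H i h⟩ rfl rfl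
    by_cases hi : i = 2 * k + 1
    · subst hi
      exact ⟨fun h => absurd h hd, fun h => by omega⟩
    · exact H i h (by omega)

lemma tailAltSum_self (n : ℕ) : tailAltSum q (2 * n + 1) n = 1 := by
  have key : ∀ σ : Equiv.Perm (Fin (2 * n + 1)), (∀ i : ℕ, (h : i + 1 < 2 * n + 1) →
      (σ ⟨i + 1, h⟩ < σ ⟨i, Nat.lt_of_succ_lt h⟩ ↔ Odd i ∧ 2 * n ≤ i)) ↔ σ = 1 := by
    intro σ
    constructor
    · intro H
      have hmono : StrictMono σ := by
        refine Fin.strictMono_iff_lt_succ.mpr fun i => ?_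
        refine lt_of_le_of_ne (not_lt.mp fun hlt => ?_) fun he => ?_
        · have := (H i (by omega)).mp hlt
          omega
        · exact (Fin.castSucc_lt_succ (i := i)).ne (σ.injective he)
      have := Subsingleton.elim (hmono.orderIsoOfSurjective σ σ.surjective) (OrderIso.refl _)
      ext i
      exact congrArg Fin.val (DFunLike.congr_fun this i)
    · rintro rfl i h
      simp only [Equiv.Perm.coe_one, id, Fin.mk_lt_mk]
      omega
  have hmaj : maj (1 : Equiv.Perm (Fin (2 * n + 1))) = 0 := by
    refine Finset.sum_eq_zero fun i hi => ?_
    obtain ⟨-, h, hlt⟩ := Finset.mem_filter.mp hi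
    simp [Fin.lt_def] at hlt
  rw [tailAltSum, Finset.sum_congr rfl fun σ _ => if_congr (key σ) rfl rfl]
  simp [hmaj]

lemma extSum_chainZigzag (hq : ∀ n : ℕ, q ^ (n + 1) ≠ 1) {n k : ℕ} (hk : k ≤ n) :
    extSum q (chainZigzag k) (2 * n + 1) (Finset.range (2 * n + 1)) (2 * n + 1) =
      gaussBinom q (2 * k) (2 * (n - k) + 1) * tailAltSum q (2 * (n - k) + 1) 0 := by
  have hS : Finset.range (2 * n + 1) =
      Finset.range (2 * k) ∪ Finset.Ico (2 * k) (2 * n + 1) := by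
    ext z
    simp only [Finset.mem_union, Finset.mem_range, Finset.mem_Ico]
    omega
  have hI : Finset.Ico (2 * k) (2 * n + 1) =
      (Finset.range (2 * (n - k) + 1)).map (addRightEmbedding (2 * k)) := by
    rw [Finset.range_eq_Ico, Finset.map_add_right_Ico]
    congr 1 <;> omega
  have hm : 2 * n + 1 = 2 * (n - k) + 1 + 2 * k := by omega
  conv_lhs => rw [hS]
  rw [(extSum_range_union (a := 2 * k) (m := 2 * n + 1) hq (R := chainZigzag k) ?_ ?_ ?_
    (2 * n + 1) (2 * k) (2 * (n - k) + 1) (by omega) le_rfl _ subset_rfl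
    (by rw [Nat.card_Ico]; omega)).1 _ (by omega), hI]
  · congr 1
    conv_lhs => rw [hm]
    rw [extSum_map_add, tailAltSum_zero, ← extSum_chainZigzag_zero]
    refine extSum_congr q _ _ _ fun i _ j _ => ?_
    simp only [chainZigzag, Nat.even_iff, Nat.odd_iff]
    omega
  · intro j hj
    exact Or.inl ⟨rfl, Or.inl hj⟩
  · rintro j y hj (⟨h1, h2⟩ | ⟨h1, h2, h3⟩) <;> omega
  · rintro y z hy (⟨h1, h2⟩ | ⟨h1, h2, h3⟩) <;> omega

/-- The generating function of the reverse alternating permutations of `2 * n + 1` letters,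
divided by `(q;q)_{2n+1}`. -/
noncomputable def qTangent (q : K) (n : ℕ) : K :=
  tailAltSum q (2 * n + 1) 0 / qPoch q (2 * n + 1)

lemma sum_qTangent (hq : ∀ n : ℕ, q ^ (n + 1) ≠ 1) (n : ℕ) :
    ∑ k ∈ Finset.range (n + 1), (-1) ^ k / qPoch q (2 * k) * qTangent q (n - k) =
      (-1) ^ n / qPoch q (2 * n + 1) := by
  have hpart : ∀ j ≤ n, ∑ k ∈ Finset.range (j + 1),
      (-1) ^ k / qPoch q (2 * k) * qTangent q (n - k) =
        (-1) ^ j * tailAltSum q (2 * n + 1) j / qPoch q (2 * n + 1) := by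
    intro j
    induction j with
    | zero => simp [qPoch_zero, qTangent]
    | succ j ih =>
      intro hj
      have h := extSum_chainZigzag hq hj
      rw [extSum_chainZigzag_succ (by omega), gaussBinom,
        show 2 * (j + 1) + (2 * (n - (j + 1)) + 1) = 2 * n + 1 by omega] at h
      rw [Finset.sum_range_succ, ih (by omega), eq_sub_of_add_eq h, qTangent]
      have h1 := qPoch_ne_zero hq (2 * n + 1)
      have h2 := qPoch_ne_zero hq (2 * (j + 1))
      have h3 := qPoch_ne_zero hq (2 * (n - (j + 1)) + 1)
      field_simp
      ring
  rw [hpart n le_rfl, tailAltSum_self, mul_one]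

end Tangent

section DyckPaths

variable {K : Type*} [Field K]

/-- Weighted count of the nonnegative paths with `m` steps from height `h` to height `0`. -/
noncomputable def pathSum (wt : ℤ → K) (m : ℕ) (h : ℤ) : K :=
  ∑ s : Fin m → Bool, if (∀ i ≤ m, 0 ≤ h + pathHeight s i) ∧ h + pathHeight s m = 0 then
    ∏ i ∈ Finset.range (m + 1), wt (h + pathHeight s i) else 0

lemma pathHeight_zero {m : ℕ} (s : Fin m → Bool) : pathHeight s 0 = 0 := by simp [pathHeight]

lemma pathHeight_cons {m : ℕ} (b : Bool) (s : Fin m → Bool) (i : ℕ) :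
    pathHeight (Fin.cons b s : Fin (m + 1) → Bool) (i + 1) =
      (if b then 1 else -1) + pathHeight s i := by
  simp [pathHeight, Fin.sum_univ_succ]

lemma pathSum_zero (wt : ℤ → K) (h : ℤ) : pathSum wt 0 h = if h = 0 then wt 0 else 0 := by
  by_cases hh : h = 0 <;> simp [pathSum, pathHeight_zero, hh]

lemma pathSum_of_neg (wt : ℤ → K) (m : ℕ) {h : ℤ} (hh : h < 0) : pathSum wt m h = 0 := by
  refine Finset.sum_eq_zero fun s _ => if_neg fun H => ?_
  have := H.1 0 (Nat.zero_le _)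
  rw [pathHeight_zero] at this
  omega

lemma pathSum_succ (wt : ℤ → K) (m : ℕ) {h : ℤ} (hh : 0 ≤ h) :
    pathSum wt (m + 1) h = wt h * (pathSum wt m (h + 1) + pathSum wt m (h - 1)) := by
  have key : ∀ (b : Bool) (s : Fin m → Bool),
      (if (∀ i ≤ m + 1, 0 ≤ h + pathHeight (Fin.cons b s : Fin (m + 1) → Bool) i) ∧
          h + pathHeight (Fin.cons b s : Fin (m + 1) → Bool) (m + 1) = 0 then
        ∏ i ∈ Finset.range (m + 1 + 1),
          wt (h + pathHeight (Fin.cons b s : Fin (m + 1) → Bool) i) else 0) =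
      wt h * if (∀ i ≤ m, 0 ≤ h + (if b then 1 else -1) + pathHeight s i) ∧
          h + (if b then 1 else -1) + pathHeight s m = 0 then
        ∏ i ∈ Finset.range (m + 1), wt (h + (if b then 1 else -1) + pathHeight s i) else 0 := by
    intro b s
    rw [mul_ite, mul_zero, Finset.prod_range_succ']
    simp only [pathHeight_cons, pathHeight_zero, add_zero, ← add_assoc]
    rw [mul_comm (wt h)]
    refine if_congr (and_congr_left fun _ => ⟨fun H i hi => ?_, fun H i hi => ?_⟩) rfl rfl
    · have := H (i + 1) (by omega)
      rwa [pathHeight_cons, ← add_assoc] at this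
    · rcases i with _ | i
      · rwa [pathHeight_zero, add_zero]
      · rw [pathHeight_cons, ← add_assoc]
        exact H i (by omega)
  rw [pathSum, ← Equiv.sum_comp (Fin.consEquiv fun _ : Fin (m + 1) => Bool),
    Fintype.sum_prod_type, Fintype.sum_bool, mul_add, pathSum, pathSum, Finset.mul_sum,
    Finset.mul_sum]
  congr 1
  · exact Finset.sum_congr rfl fun s _ => key true s
  · exact Finset.sum_congr rfl fun s _ => key false s

lemma pathSum_of_lt (wt : ℤ → K) (m : ℕ) : ∀ h : ℤ, (m : ℤ) < h → pathSum wt m h = 0 := by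
  induction m with
  | zero =>
    intro h hh
    rw [pathSum_zero, if_neg (by simpa using hh.ne')]
  | succ m ih =>
    intro h hh
    push_cast at hh
    rw [pathSum_succ _ _ (by omega), ih _ (by omega), ih _ (by omega), add_zero, mul_zero]

/-- A sequence of power series satisfying a three-term recurrence is the generating function of
weighted paths. -/
lemma pathSum_eq_coeff (wt : ℤ → K) (F : ℕ → PowerSeries K) (h0 : F 0 = 1)
    (hrec : ∀ h : ℕ, F (h + 1) =
      PowerSeries.C (wt h) * (F h + PowerSeries.X * F (h + 2))) (m : ℕ) :
    ∀ h j : ℕ, h + 2 * j = m → pathSum wt m h = PowerSeries.coeff j (F (h + 1)) := by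
  induction m with
  | zero =>
    intro h j hm
    obtain rfl : h = 0 := by omega
    obtain rfl : j = 0 := by omega
    rw [pathSum_zero, hrec, h0]
    simp
  | succ m ih =>
    intro h j hm
    rw [pathSum_succ _ _ (by omega), hrec, PowerSeries.coeff_C_mul, map_add, add_comm]
    congr 2
    · rcases h with _ | h
      · rw [pathSum_of_neg _ _ (by simp), h0, PowerSeries.coeff_one, if_neg (by omega)]
      · rw [← ih h j (by omega)]
        congr 1
        push_cast
        ring
    · rcases j with _ | j
      · rw [pathSum_of_lt _ _ _ (by omega)]
        simp
      · rw [PowerSeries.coeff_succ_X_mul, ← ih (h + 1) j (by omega)]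
        congr 1

/-- A `q`-analogue of the Bessel functions of half-integral order; the quotient of the first two
members is the generating function of `qTangent`. -/
noncomputable def besselSeries (q : K) : ℕ → PowerSeries K
  | 0 => PowerSeries.mk fun k => (-1) ^ k / qPoch q (2 * k)
  | h + 1 => PowerSeries.mk fun k => (-1) ^ k * q ^ (∑ i ∈ Finset.range (h + 1), i) *
      (∏ i ∈ Finset.range h, (1 - q ^ (2 * k + 2 * i + 2))) / qPoch q (2 * k + 2 * h + 1)

lemma besselSeries_succ {q : K} (hq : ∀ n : ℕ, q ^ (n + 1) ≠ 1) (h : ℕ) :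
    besselSeries q (h + 1) = PowerSeries.C (q ^ h / (1 - q ^ (2 * h + 1))) *
      (besselSeries q h + PowerSeries.X * besselSeries q (h + 2)) := by
  have hh := one_sub_pow_succ_ne_zero hq (2 * h)
  ext k
  rw [PowerSeries.coeff_C_mul, map_add]
  rcases k with _ | k
  · rw [PowerSeries.coeff_zero_X_mul, add_zero]
    rcases h with _ | h
    · simp [besselSeries, qPoch]
    · have h1 := qPoch_ne_zero hq (2 * h + 1)
      have h2 := one_sub_pow_succ_ne_zero hq (2 * h + 1)
      simp only [besselSeries, PowerSeries.coeff_mk,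
        show 2 * 0 + 2 * (h + 1) + 1 = 2 * h + 1 + 1 + 1 by ring,
        show 2 * 0 + 2 * h + 1 = 2 * h + 1 by ring, qPoch_succ _ (2 * h + 1 + 1),
        qPoch_succ _ (2 * h + 1), Finset.prod_range_succ _ h, Finset.sum_range_succ _ (h + 1),
        pow_add q _ (h + 1), show 2 * 0 + 2 * h + 2 = 2 * h + 1 + 1 by ring]
      rw [show 2 * (h + 1) + 1 = 2 * h + 1 + 1 + 1 by ring] at hh ⊢
      field_simp
  · rw [PowerSeries.coeff_succ_X_mul]
    rcases h with _ | h
    · have h1 := qPoch_ne_zero hq (2 * k)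
      have h2 := one_sub_pow_succ_ne_zero hq (2 * k)
      have h3 := one_sub_pow_succ_ne_zero hq (2 * k + 1)
      have h4 := one_sub_pow_succ_ne_zero hq (2 * k + 1 + 1)
      simp only [besselSeries, PowerSeries.coeff_mk,
        show 2 * (k + 1) = 2 * k + 1 + 1 by ring,
        show 2 * k + 2 * (0 + 1) + 1 = 2 * k + 1 + 1 + 1 by ring, qPoch_succ _ (2 * k + 1 + 1),
        qPoch_succ _ (2 * k + 1), qPoch_succ _ (2 * k), Finset.sum_range_succ,
        Finset.prod_range_succ, Finset.sum_range_zero, Finset.prod_range_zero]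
      field_simp
      ring
    · have h1 := qPoch_ne_zero hq (2 * k + 2 * h + 3)
      have h2 := one_sub_pow_succ_ne_zero hq (2 * k + 2 * h + 3)
      have h3 := one_sub_pow_succ_ne_zero hq (2 * k + 2 * h + 3 + 1)
      have hp : ∏ i ∈ Finset.range (h + 1 + 1), (1 - q ^ (2 * k + 2 * i + 2)) =
          (∏ i ∈ Finset.range h, (1 - q ^ (2 * (k + 1) + 2 * i + 2))) *
            (1 - q ^ (2 * k + 2 * h + 3 + 1)) * (1 - q ^ (2 * k + 2)) := by
        rw [Finset.prod_range_succ', Finset.prod_range_succ]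
        congr 2
        · refine Finset.prod_congr rfl fun i _ => ?_
          ring
      simp only [besselSeries, PowerSeries.coeff_mk, hp,
        show 2 * (k + 1) + 2 * (h + 1) + 1 = 2 * k + 2 * h + 3 + 1 + 1 by ring,
        show 2 * (k + 1) + 2 * h + 1 = 2 * k + 2 * h + 3 by ring,
        show 2 * (k + 1) + 2 * h + 2 = 2 * k + 2 * h + 3 + 1 by ring,
        show 2 * k + 2 * (h + 1 + 1) + 1 = 2 * k + 2 * h + 3 + 1 + 1 by ring,
        qPoch_succ _ (2 * k + 2 * h + 3 + 1),
        qPoch_succ _ (2 * k + 2 * h + 3), Finset.prod_range_succ _ h,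
        Finset.sum_range_succ _ (h + 2), Finset.sum_range_succ _ (h + 1),
        pow_add q _ (h + 1), pow_add q _ (h + 2)]
      field_simp
      ring

lemma pathSum_eq_qTangent {q : K} (hq : ∀ n : ℕ, q ^ (n + 1) ≠ 1) (wt : ℤ → K)
    (hwt : ∀ h : ℕ, wt h = q ^ h / (1 - q ^ (2 * h + 1))) (n : ℕ) :
    pathSum wt (2 * n) 0 = qTangent q n := by
  have hinv : besselSeries q 0 * (besselSeries q 0)⁻¹ = 1 :=
    PowerSeries.mul_inv_cancel _ (by simp [besselSeries, qPoch_zero])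
  have htan : besselSeries q 0 * PowerSeries.mk (qTangent q) = besselSeries q 1 := by
    ext n
    rw [PowerSeries.coeff_mul, Finset.Nat.sum_antidiagonal_eq_sum_range_succ_mk]
    simp only [besselSeries, PowerSeries.coeff_mk]
    rw [sum_qTangent hq]
    simp
  have h := pathSum_eq_coeff wt (fun h => besselSeries q h * (besselSeries q 0)⁻¹) hinv
    (fun h => by
      rw [besselSeries_succ hq, hwt]
      ring) (2 * n) 0 n (by ring)
  rw [Nat.cast_zero] at h
  rw [h, zero_add, ← htan, mul_right_comm, hinv, one_mul, PowerSeries.coeff_mk]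

end DyckPaths

lemma ratFunc_X_pow_succ_ne_one (n : ℕ) : (RatFunc.X : RatFunc ℚ) ^ (n + 1) ≠ 1 := by
  rw [← RatFunc.algebraMap_X, ← map_pow, Ne, map_eq_one_iff _ (RatFunc.algebraMap_injective ℚ)]
  intro h
  have := congrArg Polynomial.natDegree h
  simp at this

/-- `Σ_{Dyck paths} ∏_{i=0}^{2n} q^{h_i}/(1-q^{2h_i+1}) = E_{2n+1}(q)/(q;q)_{2n+1}`
over the field of rational functions in `q`, where
`E_{2n+1}(q) = Σ_{σ ∈ RevAlt_{2n+1}} q^{maj(σ⁻¹)}`. -/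
theorem dyck_weighted_sum_eq_qTangent (n : ℕ) :
    ∑ s ∈ dyckPaths n, ∏ i ∈ Finset.range (2 * n + 1),
        ((RatFunc.X : RatFunc ℚ) ^ (pathHeight s i) /
          (1 - RatFunc.X ^ (2 * pathHeight s i + 1))) =
    (∑ σ ∈ Finset.univ.filter fun σ : Equiv.Perm (Fin (2 * n + 1)) => IsRevAlt σ,
        (RatFunc.X : RatFunc ℚ) ^ (maj σ⁻¹)) /
      ∏ i ∈ Finset.range (2 * n + 1), (1 - (RatFunc.X : RatFunc ℚ) ^ (i + 1)) := by
  have h := pathSum_eq_qTangent ratFunc_X_pow_succ_ne_one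
    (fun h : ℤ => (RatFunc.X : RatFunc ℚ) ^ h / (1 - RatFunc.X ^ (2 * h + 1)))
    (fun h => by norm_cast) n
  rw [qTangent, tailAltSum_zero, ← Finset.sum_filter, qPoch, pathSum, ← Finset.sum_filter] at h
  simp only [zero_add] at h
  rw [← h, dyckPaths]
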